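/- arXiv:1708.07088 — 3 statements merged into one kernel-verified Lean document; each statement's English description precedes it below -/
import Mathlib

section
/- For every cluster k ∈ K and file f ∈ F, the set function A ↦ d(A, k, f) on subsets of K × F is supermodular: for all cache placements A ⊆ B ⊆ K × F and every element x ∈ (K × F) \ B, d(A ∪ {x}, k, f) − d(A, k, f) ≤ d(B ∪ {x}, k, f) − d(B, k, f). -/
/-- Per-request delay of a request for file `f` in cluster `k` under cache placement
`A ⊆ K × F`: `S̄/R_D` if `f` is cached locally, `S̄/R_WL` if it is only cached in some
remote cluster, and `S̄/R_BH` if it is cached nowhere. -/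
noncomputable def delay {K F : Type*} [Fintype K] [DecidableEq K] [DecidableEq F]
    (Sbar RD RWL RBH : ℝ) (A : Finset (K × F)) (k : K) (f : F) : ℝ :=
  if (k, f) ∈ A then Sbar / RD
  else if ∃ j : K, j ≠ k ∧ (j, f) ∈ A then Sbar / RWL
  else Sbar / RBH

/-- If the propositions `LA`, `RA` imply `LB`, `RB`, then adjoining to them one of two mutually
exclusive propositions `l`, `r` changes the value of the two-level conditional `a ≤ b ≤ c`
at `LA`, `RA` by at most as much as at `LB`, `RB`. -/
theorem ite_sub_ite_le_ite_sub_ite {a b c : ℝ} (hab : a ≤ b) (hbc : b ≤ c)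
    {l r LA RA LB RB : Prop} [Decidable LA] [Decidable RA] [Decidable LB] [Decidable RB]
    [Decidable (l ∨ LA)] [Decidable (r ∨ RA)] [Decidable (l ∨ LB)] [Decidable (r ∨ RB)]
    (hL : LA → LB) (hR : RA → RB) (hlr : l → ¬r) :
    (if l ∨ LA then a else if r ∨ RA then b else c) - (if LA then a else if RA then b else c) ≤
      (if l ∨ LB then a else if r ∨ RB then b else c) -
        (if LB then a else if RB then b else c) := by
  by_cases l <;> by_cases r <;> by_cases LA <;> by_cases RA <;> by_cases LB <;> by_cases RB <;>
    simp_all <;> linarith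

/-- For every cluster `k` and file `f`, the set function `A ↦ d(A,k,f)` is supermodular:
for all `A ⊆ B ⊆ K × F` and every `x ∉ B`,
`d(A ∪ {x},k,f) − d(A,k,f) ≤ d(B ∪ {x},k,f) − d(B,k,f)`. -/
theorem delay_supermodular {K F : Type*} [Fintype K] [DecidableEq K] [Nonempty K]
    [Fintype F] [DecidableEq F] [Nonempty F]
    (Sbar RD RWL RBH : ℝ) (hS : 0 < Sbar)
    (hDWL : RWL < RD) (hWLBH : RBH < RWL) (hBH : 0 < RBH)
    (k : K) (f : F) (A B : Finset (K × F)) (hAB : A ⊆ B)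
    (x : K × F) (hx : x ∉ B) :
    delay Sbar RD RWL RBH (insert x A) k f - delay Sbar RD RWL RBH A k f ≤
      delay Sbar RD RWL RBH (insert x B) k f - delay Sbar RD RWL RBH B k f := by
  have hDW : Sbar / RD < Sbar / RWL := div_lt_div_of_pos_left hS (hBH.trans hWLBH) hDWL
  have hWH : Sbar / RWL < Sbar / RBH := div_lt_div_of_pos_left hS hBH hWLBH
  have hlocal : (k, f) ∈ A → (k, f) ∈ B := fun h => hAB h
  have hremote : (∃ j : K, j ≠ k ∧ (j, f) ∈ A) → ∃ j : K, j ≠ k ∧ (j, f) ∈ B :=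
    fun ⟨j, hj, h⟩ => ⟨j, hj, hAB h⟩
  have hinsert (C : Finset (K × F)) : (∃ j : K, j ≠ k ∧ (j, f) ∈ insert x C) ↔
      (x.1 ≠ k ∧ x.2 = f) ∨ ∃ j : K, j ≠ k ∧ (j, f) ∈ C := by
    simp only [Finset.mem_insert, Prod.ext_iff]
    grind
  have hxk : (k, f) = x → ¬(x.1 ≠ k ∧ x.2 = f) := by
    rintro rfl
    simp
  simp only [delay, hinsert]
  simp only [Finset.mem_insert]
  exact ite_sub_ite_le_ite_sub_ite hDW.le hWH.le hlocal hremote hxk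
end

section
/- Let w : K × F → ℝ be nonnegative weights and define the weighted average delay G(A) = Σ_{(k,f) ∈ K × F} w(k,f) · d(A, k, f) for cache placements A ⊆ K × F. Then G is monotone non-increasing (A ⊆ B implies G(B) ≤ G(A)) and supermodular (for all A ⊆ B ⊆ K × F and x ∉ B, G(A ∪ {x}) − G(A) ≤ G(B ∪ {x}) − G(B)). -/
/-- The indicator that no element of a placement `A` satisfies `T`. -/
noncomputable def missIndicator {α : Type*} (T : α → Prop) (A : Finset α) : ℝ :=
  open Classical in if ∀ a ∈ A, ¬ T a then 1 else 0

lemma missIndicator_anti {α : Type*} (T : α → Prop) {A B : Finset α} (h : A ⊆ B) :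
    missIndicator T B ≤ missIndicator T A := by
  unfold missIndicator
  split_ifs with hB hA
  · exact le_rfl
  · exact absurd (fun a ha => hB a (h ha)) hA
  · exact zero_le_one
  · exact le_rfl

lemma missIndicator_insert_of_pos {α : Type*} [DecidableEq α] {T : α → Prop} (A : Finset α)
    {x : α} (hx : T x) : missIndicator T (insert x A) = 0 :=
  if_neg fun h => h x (Finset.mem_insert_self x A) hx

lemma missIndicator_insert_of_neg {α : Type*} [DecidableEq α] {T : α → Prop} (A : Finset α)
    {x : α} (hx : ¬ T x) : missIndicator T (insert x A) = missIndicator T A := by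
  have h : (∀ a ∈ insert x A, ¬ T a) ↔ ∀ a ∈ A, ¬ T a := by simp [hx]
  unfold missIndicator
  split_ifs <;> tauto

lemma missIndicator_supermodular {α : Type*} [DecidableEq α] (T : α → Prop) {A B : Finset α}
    (h : A ⊆ B) (x : α) :
    missIndicator T (insert x A) - missIndicator T A ≤
      missIndicator T (insert x B) - missIndicator T B := by
  have hAB := missIndicator_anti T h
  by_cases hx : T x
  · rw [missIndicator_insert_of_pos A hx, missIndicator_insert_of_pos B hx]
    linarith
  · rw [missIndicator_insert_of_neg A hx, missIndicator_insert_of_neg B hx]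
    linarith

lemma delay_eq_missIndicator {K F : Type*} [Fintype K] [DecidableEq K] [DecidableEq F]
    (Sbar RD RWL RBH : ℝ) (A : Finset (K × F)) (k : K) (f : F) :
    delay Sbar RD RWL RBH A k f = Sbar / RD
      + (Sbar / RWL - Sbar / RD) * missIndicator (fun p => p = (k, f)) A
      + (Sbar / RBH - Sbar / RWL) * missIndicator (fun p => p.2 = f) A := by
  have hlocal : (∀ p ∈ A, ¬ p = (k, f)) ↔ (k, f) ∉ A :=
    ⟨fun h hkf => h _ hkf rfl, fun h p hp hpkf => h (hpkf ▸ hp)⟩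
  have hglobal : (∀ p ∈ A, ¬ p.2 = f) ↔ (k, f) ∉ A ∧ ¬ ∃ j : K, j ≠ k ∧ (j, f) ∈ A := by
    constructor
    · exact fun h => ⟨fun hkf => h _ hkf rfl, fun ⟨j, _, hj⟩ => h _ hj rfl⟩
    · rintro ⟨hkf, hj⟩ ⟨j, g⟩ hp rfl
      by_cases hjk : j = k
      · exact hkf (hjk ▸ hp)
      · exact hj ⟨j, hjk, hp⟩
  unfold delay missIndicator
  simp only [hlocal, hglobal]
  by_cases hkf : (k, f) ∈ A
  · simp [hkf]
  · by_cases hj : ∃ j : K, j ≠ k ∧ (j, f) ∈ A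
    · simp only [hkf, hj, not_true_eq_false, not_false_eq_true, and_false, if_true, if_false]
      ring
    · simp only [hkf, hj, not_false_eq_true, and_self, if_true, if_false]
      ring

/-- The weighted average delay `G(A) = Σ_{(k,f)} w(k,f)·d(A,k,f)` with nonnegative
weights is monotone non-increasing and supermodular in the cache placement `A`. -/
theorem weighted_delay_monotone_supermodular {K F : Type*}
    [Fintype K] [DecidableEq K] [Nonempty K] [Fintype F] [DecidableEq F] [Nonempty F]
    (Sbar RD RWL RBH : ℝ) (hS : 0 < Sbar)
    (hDWL : RWL < RD) (hWLBH : RBH < RWL) (hBH : 0 < RBH)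
    (w : K × F → ℝ) (hw : ∀ p : K × F, 0 ≤ w p)
    (G : Finset (K × F) → ℝ)
    (hG : ∀ A : Finset (K × F),
      G A = ∑ p : K × F, w p * delay Sbar RD RWL RBH A p.1 p.2) :
    (∀ A B : Finset (K × F), A ⊆ B → G B ≤ G A) ∧
    (∀ A B : Finset (K × F), A ⊆ B → ∀ x ∉ B,
      G (insert x A) - G A ≤ G (insert x B) - G B) := by
  have hlocal : 0 ≤ Sbar / RWL - Sbar / RD :=
    sub_nonneg.2 (div_le_div_of_nonneg_left hS.le (hBH.trans hWLBH) hDWL.le)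
  have hglobal : 0 ≤ Sbar / RBH - Sbar / RWL :=
    sub_nonneg.2 (div_le_div_of_nonneg_left hS.le hBH hWLBH.le)
  refine ⟨fun A B hAB => ?_, fun A B hAB x _ => ?_⟩
  · rw [hG, hG]
    refine Finset.sum_le_sum fun p _ => mul_le_mul_of_nonneg_left ?_ (hw p)
    rw [delay_eq_missIndicator, delay_eq_missIndicator]
    gcongr <;> exact missIndicator_anti _ hAB
  · simp only [hG, ← Finset.sum_sub_distrib, ← mul_sub]
    refine Finset.sum_le_sum fun p _ => mul_le_mul_of_nonneg_left ?_ (hw p)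
    simp only [delay_eq_missIndicator]
    have h₁ := mul_le_mul_of_nonneg_left
      (missIndicator_supermodular (fun q => q = (p.1, p.2)) hAB x) hlocal
    have h₂ := mul_le_mul_of_nonneg_left
      (missIndicator_supermodular (fun q => q.2 = p.2) hAB x) hglobal
    linarith
end

section
/- Let M be a matroid on a finite ground set S with independent-set family I, and let f be a set function on subsets of S that is monotone non-decreasing (A ⊆ B implies f(A) ≤ f(B)), submodular (for all A ⊆ B and x ∉ B, f(A ∪ {x}) − f(A) ≥ f(B ∪ {x}) − f(B)), and satisfies f(∅) = 0. Let B be a base of M (a maximal independent set) that is locally optimal under single-element swaps, i.e., for every e ∈ B and e' ∈ S \ B such that (B \ {e}) ∪ {e'} is a base, f((B \ {e}) ∪ {e'}) ≤ f(B). Then for every independent set B* ∈ I, f(B*) ≤ 2·f(B). Equivalently, for a monotone non-increasing supermodular delay function D, a single-swap locally optimal base B achieves delay reduction D(∅) − D(B) within a factor 2 of the optimal delay reduction over all independent cache placements. -/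
/-- An independent set extends, by elements of an independent set `B` that is at least as large,
to an independent set of the cardinality of `B`. -/
theorem exists_indep_extension_card_eq {α : Type*} [DecidableEq α] {I : Finset α → Prop}
    (haug : ∀ A B : Finset α, I A → I B → A.card < B.card → ∃ e ∈ B \ A, I (insert e A))
    {A B : Finset α} (hA : I A) (hB : I B) (hAB : A.card ≤ B.card) :
    ∃ J, A ⊆ J ∧ J ⊆ A ∪ B ∧ I J ∧ J.card = B.card := by
  induction hn : B.card - A.card generalizing A with
  | zero => exact ⟨A, subset_rfl, Finset.subset_union_left, hA, by omega⟩
  | succ n ih =>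
    obtain ⟨e, he, hI⟩ := haug A B hA hB (by omega)
    rw [Finset.mem_sdiff] at he
    have hcard := Finset.card_insert_of_notMem he.2
    obtain ⟨J, hAJ, hJ, hIJ, hJcard⟩ := ih hI (by omega) (by omega)
    refine ⟨J, (Finset.subset_insert e A).trans hAJ, fun x hx => ?_, hIJ, hJcard⟩
    have := hJ hx
    simp only [Finset.mem_union, Finset.mem_insert] at this ⊢
    rcases this with (rfl | h) | h
    · exact Or.inr he.1
    · exact Or.inl h
    · exact Or.inr h

/-- A maximal independent set has maximum cardinality. -/
theorem card_le_card_of_maximal_indep {α : Type*} [DecidableEq α] {I : Finset α → Prop}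
    (haug : ∀ A B : Finset α, I A → I B → A.card < B.card → ∃ e ∈ B \ A, I (insert e A))
    {A B : Finset α} (hA : I A) (hB : I B)
    (hmax : ∀ A : Finset α, I A → B ⊆ A → A = B) : A.card ≤ B.card := by
  by_contra! h
  obtain ⟨e, he, hI⟩ := haug B A hB hA h
  exact (Finset.mem_sdiff.1 he).2 (Finset.insert_eq_self.1 (hmax _ hI (Finset.subset_insert e B)))

/-- The elements of an independent set outside a base `B` can be matched injectively with
elements of `B` for which they may be exchanged. -/
theorem exists_injective_exchange {α : Type*} [DecidableEq α] {I : Finset α → Prop}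
    (hdown : ∀ A B : Finset α, A ⊆ B → I B → I A)
    (haug : ∀ A B : Finset α, I A → I B → A.card < B.card → ∃ e ∈ B \ A, I (insert e A))
    {B C : Finset α} (hB : I B) (hmax : ∀ A : Finset α, I A → B ⊆ A → A = B) (hC : I C) :
    ∃ π : ↥(C \ B) → α, Function.Injective π ∧
      ∀ y, π y ∈ B ∧ I (insert (y : α) (B.erase (π y))) := by
  classical
  let t : ↥(C \ B) → Finset α := fun y => B.filter fun x => I (insert (y : α) (B.erase x))
  obtain ⟨π, hinj, hπ⟩ := (Finset.all_card_le_biUnion_card_iff_exists_injective t).1 <| by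
    intro s
    by_contra! hlt
    have hsub : s.biUnion t ⊆ B := Finset.biUnion_subset.2 fun y _ => Finset.filter_subset _ _
    let Y : Finset α := s.map (Function.Embedding.subtype _)
    have hY : I Y := by
      refine hdown _ C (fun x hx => ?_) hC
      obtain ⟨y, -, rfl⟩ := Finset.mem_map.1 hx
      exact (Finset.mem_sdiff.1 y.2).1
    obtain ⟨z, hz, hI⟩ := haug _ Y (hdown _ _ hsub hB) hY (by simpa [Y] using hlt)
    obtain ⟨y, hys, rfl⟩ := Finset.mem_map.1 (Finset.mem_sdiff.1 hz).1
    change I (insert (y : α) _) at hI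
    have hyB : (y : α) ∉ B := (Finset.mem_sdiff.1 y.2).2
    obtain ⟨J, hNJ, hJ, hIJ, hJcard⟩ := exists_indep_extension_card_eq haug hI hB
      (card_le_card_of_maximal_indep haug hI hB hmax)
    have hyJ : (y : α) ∈ J := hNJ (Finset.mem_insert_self _ _)
    obtain ⟨x, hxB, hxJ⟩ : ∃ x ∈ B, x ∉ J := by
      by_contra! h
      exact hyB (hmax J hIJ h ▸ hyJ)
    have hle : insert (y : α) (B.erase x) = J := by
      symm
      apply Finset.eq_of_subset_of_card_le
      · intro z hzJ
        have h1 := hJ hzJ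
        have h2 : z ≠ x := fun h => hxJ (h ▸ hzJ)
        simp only [Finset.mem_union, Finset.mem_insert, Finset.mem_erase] at h1 ⊢
        rcases h1 with (h | h) | h
        · exact Or.inl h
        · exact Or.inr ⟨h2, hsub h⟩
        · exact Or.inr ⟨h2, h⟩
      · rw [hJcard, Finset.card_insert_of_notMem (by simp [hyB]), Finset.card_erase_add_one hxB]
    refine hxJ (hNJ (Finset.mem_insert_of_mem (Finset.mem_biUnion.2 ⟨y, hys, ?_⟩)))
    exact Finset.mem_filter.2 ⟨hxB, hle ▸ hIJ⟩
  exact ⟨π, hinj, fun y => Finset.mem_filter.1 (hπ y)⟩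

/-- The total gain of adding a set to `B` is at most the sum of the single-element gains. -/
theorem submodular_union_sub_le_sum {α : Type*} [DecidableEq α] {f : Finset α → ℝ}
    (hsub : ∀ A B : Finset α, A ⊆ B → ∀ x ∉ B, f (insert x B) - f B ≤ f (insert x A) - f A)
    (B Y : Finset α) (hY : Disjoint Y B) :
    f (Y ∪ B) - f B ≤ ∑ y ∈ Y, (f (insert y B) - f B) := by
  induction Y using Finset.induction_on with
  | empty => simp
  | insert y Y hy ih =>
    rw [Finset.disjoint_insert_left] at hY
    have h1 := hsub B (Y ∪ B) Finset.subset_union_right y (by simp [hy, hY.1])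
    rw [Finset.sum_insert hy, Finset.insert_union]
    linarith [ih hY.2]

/-- The total loss of deleting a subset of `B` is at least the sum of the single-element losses. -/
theorem sum_le_submodular_sub_sdiff {α : Type*} [DecidableEq α] {f : Finset α → ℝ}
    (hsub : ∀ A B : Finset α, A ⊆ B → ∀ x ∉ B, f (insert x B) - f B ≤ f (insert x A) - f A)
    (B X : Finset α) (hX : X ⊆ B) :
    ∑ x ∈ X, (f B - f (B.erase x)) ≤ f B - f (B \ X) := by
  induction X using Finset.induction_on with
  | empty => simp
  | insert x X hx ih =>
    rw [Finset.insert_subset_iff] at hX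
    have h1 := hsub (B \ insert x X) (B.erase x)
      (fun z hz => by simp at hz ⊢; tauto) x (by simp)
    have h2 : insert x (B \ insert x X) = B \ X := by
      ext z
      by_cases hz : z = x
      · subst hz; simp [hX.1, hx]
      · simp [hz]
    rw [Finset.insert_erase hX.1, h2] at h1
    rw [Finset.sum_insert hx]
    linarith [ih hX.2]


/-- Factor-2 guarantee for single-swap local optima over a matroid (Fisher–Nemhauser–
Wolsey): if `I` is the independent-set family of a matroid on a finite ground set,
`f` is monotone non-decreasing, submodular, and normalized (`f ∅ = 0`), and `B` is a
base that is locally optimal under single-element swaps, then every independent set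
`B*` satisfies `f(B*) ≤ 2·f(B)`. -/
theorem local_swap_optimum_within_factor_two {α : Type*} [Fintype α] [DecidableEq α]
    (I : Finset α → Prop)
    (hne : ∃ A : Finset α, I A)
    (hdown : ∀ A B : Finset α, A ⊆ B → I B → I A)
    (haug : ∀ A B : Finset α, I A → I B → A.card < B.card →
      ∃ e ∈ B \ A, I (insert e A))
    (f : Finset α → ℝ)
    (hmono : ∀ A B : Finset α, A ⊆ B → f A ≤ f B)
    (hsub : ∀ A B : Finset α, A ⊆ B → ∀ x ∉ B,
      f (insert x B) - f B ≤ f (insert x A) - f A)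
    (hf0 : f ∅ = 0)
    (B : Finset α) (hB : I B)
    (hBbase : ∀ A : Finset α, I A → B ⊆ A → A = B)
    (hlocal : ∀ e ∈ B, ∀ e' ∉ B,
      (I (insert e' (B.erase e)) ∧
        ∀ A : Finset α, I A → insert e' (B.erase e) ⊆ A → A = insert e' (B.erase e)) →
      f (insert e' (B.erase e)) ≤ f B) :
    ∀ Bstar : Finset α, I Bstar → f Bstar ≤ 2 * f B := by
  intro C hC
  obtain ⟨π, hinj, hπ⟩ := exists_injective_exchange hdown haug hB hBbase hC
  have hgain : ∀ y : ↥(C \ B), f (insert (y : α) B) - f B ≤ f B - f (B.erase (π y)) := by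
    intro y
    have hyB : (y : α) ∉ B := (Finset.mem_sdiff.1 y.2).2
    have h1 := hlocal (π y) (hπ y).1 y hyB ⟨(hπ y).2, fun A hA hle =>
      (Finset.eq_of_subset_of_card_le hle <| by
        rw [Finset.card_insert_of_notMem (by simp [hyB]), Finset.card_erase_add_one (hπ y).1]
        exact card_le_card_of_maximal_indep haug hA hB hBbase).symm⟩
    linarith [hsub _ _ (Finset.erase_subset (π y) B) y hyB]
  have hsum : ∑ y ∈ C \ B, (f (insert y B) - f B) ≤
      ∑ x ∈ Finset.univ.image π, (f B - f (B.erase x)) := by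
    rw [← Finset.sum_coe_sort, Finset.sum_image fun _ _ _ _ h => hinj h]
    exact Finset.sum_le_sum fun y _ => hgain y
  have hadd := submodular_union_sub_le_sum hsub B (C \ B) Finset.sdiff_disjoint
  have hdel := sum_le_submodular_sub_sdiff hsub B (Finset.univ.image π)
    (Finset.image_subset_iff.2 fun y _ => (hπ y).1)
  have hCle : f C ≤ f (C \ B ∪ B) := hmono _ _ (by simp)
  have hpos := hmono ∅ (B \ Finset.univ.image π) (Finset.empty_subset _)
  linarith
end
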